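/- There is no unitary operator V on ℂ²⊗ℂ² such that (I ⊗ V ⊗ I)(|Φ+⟩_{1,2} ⊗ |Φ+⟩_{3,4}) = |χ⟩, where the operator acts as the identity on qubits 1 and 4 and as V on qubits 2 and 3. -/

import Mathlib

open scoped BigOperators

/-- Two Bell pairs `|Φ+⟩₁₂ ⊗ |Φ+⟩₃₄` as four-qubit amplitudes; basis: `0 = |H⟩`, `1 = |V⟩`.
Component at `(a,b,c,d)` is `(1/2)·[a = b]·[c = d]`. -/
noncomputable def bellPairs : Fin 2 × Fin 2 × Fin 2 × Fin 2 → ℂ :=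
  fun x => (if x.1 = x.2.1 then 1 else 0) * (if x.2.2.1 = x.2.2.2 then 1 else 0) / 2

/-- Apply a two-qubit operator `V` (a `4 × 4` matrix) to qubits 2 and 3 of a four-qubit
state, acting as the identity on qubits 1 and 4: this is `I ⊗ V ⊗ I`. -/
noncomputable def applyMid (V : Matrix (Fin 2 × Fin 2) (Fin 2 × Fin 2) ℂ)
    (f : Fin 2 × Fin 2 × Fin 2 × Fin 2 → ℂ) : Fin 2 × Fin 2 × Fin 2 × Fin 2 → ℂ :=
  fun x => ∑ b : Fin 2, ∑ c : Fin 2, V (x.2.1, x.2.2.1) (b, c) * f (x.1, b, c, x.2.2.2)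

/-- The χ state `|χ⟩ = (|HHHH⟩−|HHVV⟩−|HVHV⟩+|VHHV⟩+|HVVH⟩+|VHVH⟩+|VVHH⟩+|VVVV⟩)/(2√2)`. -/
noncomputable def chiState : Fin 2 × Fin 2 × Fin 2 × Fin 2 → ℂ :=
  fun x => ((if x = (0, 0, 0, 0) then 1 else 0) - (if x = (0, 0, 1, 1) then 1 else 0)
    - (if x = (0, 1, 0, 1) then 1 else 0) + (if x = (1, 0, 0, 1) then 1 else 0)
    + (if x = (0, 1, 1, 0) then 1 else 0) + (if x = (1, 0, 1, 0) then 1 else 0)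
    + (if x = (1, 1, 0, 0) then 1 else 0) + (if x = (1, 1, 1, 1) then 1 else 0))
    / (2 * (Real.sqrt 2 : ℂ))

/-- The amplitudes of `(I ⊗ V ⊗ I)(|Φ+⟩₁₂ ⊗ |Φ+⟩₃₄)` are half the matrix entries of `V`. -/
theorem applyMid_bellPairs (V : Matrix (Fin 2 × Fin 2) (Fin 2 × Fin 2) ℂ) (a b c d : Fin 2) :
    applyMid V bellPairs (a, b, c, d) = V (b, c) (a, d) / 2 := by
  simp [applyMid, bellPairs, div_eq_mul_inv]

/-- The χ state has the same amplitudes when qubits 1 and 4 are in `|HH⟩` or in `|VV⟩`. -/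
theorem chiState_outer_eq (b c : Fin 2) : chiState (0, b, c, 0) = chiState (1, b, c, 1) := by
  fin_cases b <;> fin_cases c <;> simp [chiState]

/-- A unitary matrix has distinct columns. -/
theorem Matrix.col_injective_of_mem_unitaryGroup {n : Type*} [Fintype n] [DecidableEq n]
    {U : Matrix n n ℂ} (hU : U ∈ Matrix.unitaryGroup n ℂ) : Function.Injective U.col := by
  intro i j hij
  by_contra hne
  have h := Matrix.mem_unitaryGroup_iff'.mp hU
  have hii := congrFun (congrFun h i) i
  have hji := congrFun (congrFun h i) j
  have hcol : ∀ k, U k i = U k j := fun k => congrFun hij k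
  simp only [Matrix.mul_apply, Matrix.one_apply_eq, Matrix.one_apply_ne hne] at hii hji
  simp only [← hcol] at hji
  exact one_ne_zero (hii.symm.trans hji)

/-- There is no unitary `V` on `ℂ²⊗ℂ²` with `(I ⊗ V ⊗ I)(|Φ+⟩₁₂ ⊗ |Φ+⟩₃₄) = |χ⟩`. -/
theorem bell_pairs_not_to_chi :
    ¬ ∃ V ∈ Matrix.unitaryGroup (Fin 2 × Fin 2) ℂ, applyMid V bellPairs = chiState := by
  rintro ⟨V, hV, h⟩
  have hcol : V.col (0, 0) = V.col (1, 1) := by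
    funext ⟨b, c⟩
    have hbc := chiState_outer_eq b c
    rw [← h, applyMid_bellPairs, applyMid_bellPairs] at hbc
    exact (div_left_inj' two_ne_zero).mp hbc
  have hne : ((0, 0) : Fin 2 × Fin 2) ≠ (1, 1) := by decide
  exact hne (Matrix.col_injective_of_mem_unitaryGroup hV hcol)
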